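/- Fix n ≥ 1 and suppose that depth I^{i−1}/I^i ≥ depth I^i/I^{i+1} for all 1 ≤ i ≤ n−1, and that the same inequalities hold for J. Then depth R/(I+J)^n = min_{i+j = n−1, i,j ≥ 0} { depth I^i/I^{i+1} + depth J^j/J^{j+1} }, where I^i/I^{i+1} is regarded as an A-module and J^j/J^{j+1} as a B-module. -/

import Mathlib

/-! Core definitions: depth via local cohomology at the maximal homogeneous ideal,
Castelnuovo–Mumford regularity via graded free resolutions, gradings on
subquotients of polynomial rings.  -/

open MvPolynomial

noncomputable section

namespace PaperHTT

variable (k : Type) [Field k]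

/-- A polynomial is homogeneous of degree `e : ℤ` (it must vanish in negative degrees). -/
def homogZ {σ : Type} (p : MvPolynomial σ k) (e : ℤ) : Prop :=
  p = 0 ∨ (0 ≤ e ∧ p.IsHomogeneous e.toNat)

/-- The maximal homogeneous ideal `(x_1, …, x_r)` of a polynomial ring. -/
def maxHomIdeal (σ : Type) : Ideal (MvPolynomial σ k) :=
  Ideal.span (Set.range MvPolynomial.X)

/-- The depth of a module over a polynomial ring with respect to the maximal homogeneous
ideal: the least `i` such that the `i`-th local cohomology is non-vanishing. -/
def depthM {σ : Type} (M : ModuleCat (MvPolynomial σ k)) : ℕ :=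
  sInf {i : ℕ | Nontrivial ((localCohomology (maxHomIdeal k σ) i).obj M)}

/-- The subquotient `p/q` of a polynomial ring, for ideals `q ≤ p`. -/
abbrev subQuot {σ : Type} (p q : Ideal (MvPolynomial σ k)) : Type :=
  ↥p ⧸ (Submodule.comap p.subtype q)

/-- The degree-`t` graded piece of `p/q`: the image of the homogeneous elements of
degree `t` of `p`. -/
def subQuotGr {σ : Type} (p q : Ideal (MvPolynomial σ k)) (t : ℤ) :
    AddSubgroup (subQuot k p q) :=
  AddSubgroup.closure
    {x | ∃ f : p, homogZ k (f : MvPolynomial σ k) t ∧ x = Submodule.Quotient.mk f}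

/-- The degree-`t` graded piece of the quotient ring `P/Q`. -/
def quotGr {σ : Type} (Q : Ideal (MvPolynomial σ k)) (t : ℤ) :
    AddSubgroup (MvPolynomial σ k ⧸ Q) :=
  AddSubgroup.closure {x | ∃ f, homogZ k f t ∧ x = Ideal.Quotient.mk Q f}

/-- The degree-`t` graded piece of an ideal `p`, viewed as a module. -/
def idealGr {σ : Type} (p : Ideal (MvPolynomial σ k)) (t : ℤ) : AddSubgroup ↥p :=
  AddSubgroup.closure {x : p | homogZ k (x : MvPolynomial σ k) t}

/-- A finite graded free resolution of a module `M` over a polynomial ring,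
with respect to a grading `gr` of `M`: `F_i` is free of rank `rk i`, with basis elements
of (twisted) degrees `tw i l`, the differentials and augmentation are graded of degree `0`,
and the complex `⋯ → F_1 → F_0 → M → 0` is exact. -/
structure GradedFreeRes (σ : Type) (M : Type) [AddCommGroup M]
    [Module (MvPolynomial σ k) M] (gr : ℤ → AddSubgroup M) where
  rk : ℕ → ℕ
  tw : (i : ℕ) → Fin (rk i) → ℤ
  bdd : ∃ N, ∀ i, N ≤ i → rk i = 0
  aug : (Fin (rk 0) → MvPolynomial σ k) →ₗ[MvPolynomial σ k] M
  d : (i : ℕ) →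
    ((Fin (rk (i + 1)) → MvPolynomial σ k) →ₗ[MvPolynomial σ k]
      (Fin (rk i) → MvPolynomial σ k))
  aug_surj : Function.Surjective aug
  exact_zero : LinearMap.range (d 0) = LinearMap.ker aug
  exact_succ : ∀ i, LinearMap.range (d (i + 1)) = LinearMap.ker (d i)
  aug_homog : ∀ l, aug (Pi.single l 1) ∈ gr (tw 0 l)
  d_homog : ∀ i l l', homogZ k (d i (Pi.single l 1) l') (tw (i + 1) l - tw i l')

/-- The Castelnuovo–Mumford regularity of a (finitely generated) graded module over a
polynomial ring: the least `r` such that `M` admits a graded free resolution with all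
twists in homological degree `i` at most `r + i`.  (By minimal free resolutions, this
agrees with `max {aⁱ(M) + i}`.) -/
def regM (σ : Type) (M : Type) [AddCommGroup M] [Module (MvPolynomial σ k) M]
    (gr : ℤ → AddSubgroup M) : ℤ :=
  sInf {r : ℤ | ∃ F : GradedFreeRes k σ M gr, ∀ i (l : Fin (F.rk i)), F.tw i l - (i : ℤ) ≤ r}

/-- Depth of the quotient ring `P/Q` as a module over `P`. -/
def depthQuot {σ : Type} (Q : Ideal (MvPolynomial σ k)) : ℕ :=
  depthM k (ModuleCat.of (MvPolynomial σ k) (MvPolynomial σ k ⧸ Q))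

/-- Depth of the subquotient `p/q` as a module over the polynomial ring. -/
def depthSubQuot {σ : Type} (p q : Ideal (MvPolynomial σ k)) : ℕ :=
  depthM k (ModuleCat.of (MvPolynomial σ k) (subQuot k p q))

/-- Depth of an ideal `p` as a module over the polynomial ring. -/
def depthIdeal {σ : Type} (p : Ideal (MvPolynomial σ k)) : ℕ :=
  depthM k (ModuleCat.of (MvPolynomial σ k) ↥p)

/-- Regularity of the quotient ring `P/Q`. -/
def regQuot {σ : Type} (Q : Ideal (MvPolynomial σ k)) : ℤ :=
  regM k σ (MvPolynomial σ k ⧸ Q) (quotGr k Q)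

/-- Regularity of the subquotient `p/q`. -/
def regSubQuot {σ : Type} (p q : Ideal (MvPolynomial σ k)) : ℤ :=
  regM k σ (subQuot k p q) (subQuotGr k p q)

/-- Regularity of an ideal `p`, viewed as a graded module. -/
def regIdeal {σ : Type} (p : Ideal (MvPolynomial σ k)) : ℤ :=
  regM k σ (↥p) (idealGr k p)

/-- A homogeneous ideal: one containing all homogeneous components of its elements. -/
def IsHomogeneousIdeal {σ : Type} (I : Ideal (MvPolynomial σ k)) : Prop :=
  ∀ f ∈ I, ∀ m : ℕ, MvPolynomial.homogeneousComponent m f ∈ I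

/-- A monomial ideal. -/
def IsMonomialIdeal {σ : Type} (I : Ideal (MvPolynomial σ k)) : Prop :=
  ∃ S : Set (σ →₀ ℕ), I = Ideal.span ((fun a => MvPolynomial.monomial a (1 : k)) '' S)

/-- A squarefree monomial ideal. -/
def IsSquarefreeMonomialIdeal {σ : Type} (I : Ideal (MvPolynomial σ k)) : Prop :=
  ∃ S : Set (σ →₀ ℕ), (∀ a ∈ S, ∀ x, a x ≤ 1) ∧
    I = Ideal.span ((fun a => MvPolynomial.monomial a (1 : k)) '' S)


/-- The quotient ring `P/Q` is Cohen–Macaulay: its depth equals its Krull dimension. -/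
def IsCMQuot {σ : Type} (Q : Ideal (MvPolynomial σ k)) : Prop :=
  (depthQuot k Q : WithBot (WithTop ℕ)) = ringKrullDim (MvPolynomial σ k ⧸ Q)

/-- An isomorphism of graded modules: a linear isomorphism matching up the gradings. -/
def GradedIso {P : Type} [CommRing P] {M N : Type} [AddCommGroup M] [Module P M]
    [AddCommGroup N] [Module P N] (grM : ℤ → AddSubgroup M) (grN : ℤ → AddSubgroup N) :
    Prop :=
  ∃ e : M ≃ₗ[P] N, ∀ t, (grM t).map e.toLinearMap.toAddMonoidHom = grN t

/-- `gr` is an (internal, ℤ-) grading of the module `M` over a polynomial ring,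
compatible with the standard grading of the polynomial ring. -/
def IsGrading (σ : Type) {M : Type} [AddCommGroup M] [Module (MvPolynomial σ k) M]
    (gr : ℤ → AddSubgroup M) : Prop :=
  DirectSum.IsInternal (fun t : ℤ => gr t) ∧
    ∀ (p : MvPolynomial σ k) (d : ℕ) (t : ℤ) (m : M), p.IsHomogeneous d → m ∈ gr t →
      p • m ∈ gr (t + d)

/-- The polynomial ring `A = k[x_1,…,x_r]`. -/
abbrev PA (r : ℕ) : Type := MvPolynomial (Fin r) k

/-- The polynomial ring `B = k[y_1,…,y_s]`. -/
abbrev PB (s : ℕ) : Type := MvPolynomial (Fin s) k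

/-- The polynomial ring `R = k[x_1,…,x_r,y_1,…,y_s]`. -/
abbrev PR (r s : ℕ) : Type := MvPolynomial (Fin r ⊕ Fin s) k

/-- The extension of an ideal `I ⊆ A` to `R`. -/
def extA {r s : ℕ} (I : Ideal (PA k r)) : Ideal (PR k r s) :=
  I.map (MvPolynomial.rename (Sum.inl : Fin r → Fin r ⊕ Fin s))

/-- The extension of an ideal `J ⊆ B` to `R`. -/
def extB {r s : ℕ} (J : Ideal (PB k s)) : Ideal (PR k r s) :=
  J.map (MvPolynomial.rename (Sum.inr : Fin s → Fin r ⊕ Fin s))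

/-- The ideal `I + J ⊆ R`. -/
def sumIJ {r s : ℕ} (I : Ideal (PA k r)) (J : Ideal (PB k s)) : Ideal (PR k r s) :=
  extA k I + extB k J

end PaperHTT

end

universe u

section
open CategoryTheory Limits

namespace CategoryTheory.ProjectiveResolution
variable {C : Type*} [Category* C] [Abelian C] [HasExt C] {X Y : C}

lemma extMk_zero_eq_zero_iff (P : ProjectiveResolution X) (f : P.complex.X 0 ⟶ Y)
    (hf : P.complex.d 1 0 ≫ f = 0) : P.extMk f 1 rfl hf = 0 ↔ f = 0 := by
  refine ⟨fun h ↦ ?_, fun h ↦ by subst h; simp⟩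
  rw [← P.extEquivCohomologyClass.apply_eq_iff_eq,
    extEquivCohomologyClass_extMk, extEquivCohomologyClass_zero,
    CochainComplex.HomComplex.CohomologyClass.mk_eq_zero_iff] at h
  rw [CochainComplex.HomComplex.Cocycle.toSingleMk_mem_coboundaries_iff _ _ _ _ _ 1 (by lia)] at h
  obtain ⟨g, hg⟩ := h
  have : IsZero (P.cochainComplex.X 1) := by
    exact CochainComplex.isZero_of_isStrictlyLE P.cochainComplex 0 1
  rw [this.eq_of_src g 0, comp_zero] at hg
  simpa using hg.symm

lemma extMk_eq_zero_iff_exists_prev (P : ProjectiveResolution X) {n : ℕ} (f : P.complex.X n ⟶ Y)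
    (hf : P.complex.d (n + 1) n ≫ f = 0) :
    P.extMk f (n + 1) rfl hf = 0 ↔
      ∃ g : P.complex.X ((ComplexShape.up ℕ).prev n) ⟶ Y,
        P.complex.d n ((ComplexShape.up ℕ).prev n) ≫ g = f := by
  cases n with
  | zero =>
    rw [extMk_zero_eq_zero_iff]
    rw [show (ComplexShape.up ℕ).prev 0 = 0 by simp]
    rw [P.complex.shape 0 0 (by simp)]
    simp [eq_comm]
  | succ p =>
    rw [P.extMk_eq_zero_iff f _ rfl hf p rfl]
    rw [show (ComplexShape.up ℕ).prev (p + 1) = p by simp]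

end CategoryTheory.ProjectiveResolution

variable {R : Type u} [CommRing R]

lemma nontrivial_ext_iff (X Y : ModuleCat.{u} R) (n : ℕ) :
    Nontrivial (((Ext R (ModuleCat.{u} R) n).obj (.op X)).obj Y) ↔
      Nontrivial (Abelian.Ext X Y n) := by
  let P := projectiveResolution X
  rw [← not_subsingleton_iff_nontrivial, ← not_subsingleton_iff_nontrivial, not_iff_not,
    ← ModuleCat.isZero_iff_subsingleton, (P.isoExt (R := R) n Y).isZero_iff,
    ← HomologicalComplex.exactAt_iff_isZero_homology,
    HomologicalComplex.exactAt_iff' _ _ n (n + 1) rfl (by simp), ShortComplex.moduleCat_exact_iff]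
  constructor
  · intro h
    refine subsingleton_of_forall_eq 0 fun α ↦ ?_
    obtain ⟨f, hf, rfl⟩ := P.extMk_surjective α (n + 1) rfl
    rw [P.extMk_eq_zero_iff_exists_prev]
    exact h f hf
  · intro h f hf
    exact (P.extMk_eq_zero_iff_exists_prev f hf).1 (Subsingleton.elim _ _)

lemma epi_of_epi_comp_iso_hom {C : Type*} [Category* C] {X Y Z : C} (f : X ⟶ Y) (e : Y ≅ Z)
    (h : Epi (f ≫ e.hom)) : Epi f :=
  (epi_comp_iff_of_isIso f e.hom).1 h

lemma mono_ext_map_app {X X' : ModuleCat.{u} R} (g : X' ⟶ X) (Y : ModuleCat.{u} R) (n : ℕ)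
    (h : ∀ α : Abelian.Ext X Y n, (Abelian.Ext.mk₀ g).comp α (zero_add n) = 0 → α = 0) :
    Mono (((Ext R (ModuleCat.{u} R) n).map g.op).app Y) := by
  let P := projectiveResolution X
  let P' := projectiveResolution X'
  let φ : ProjectiveResolution.Hom P' P g := ⟨ProjectiveResolution.lift g P' P, by
    exact congr_arg (fun f ↦ f.f 0) (ProjectiveResolution.lift_commutes g P' P)⟩
  let F := ((linearYoneda R (ModuleCat.{u} R)).obj Y).rightOp
  change Mono ((F.leftDerived n).map g).unop
  suffices H : Epi ((F.leftDerived n).map g) from inferInstance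
  let ψ : P.complex.linearYonedaObj R Y ⟶ P'.complex.linearYonedaObj R Y :=
    (HomologicalComplex.unopFunctor _ _).map ((F.mapHomologicalComplex _).map φ.hom).op
  have hψ : Mono (HomologicalComplex.homologyMap ψ n) := by
    rw [HomologicalComplex.mono_homologyMap_iff_up_to_refinements _ _ n (n + 1) rfl (by simp)]
    intro A x hx y hxy
    have hr : ∀ a, ∃ b,
        (P.complex.linearYonedaObj R Y).d ((ComplexShape.up ℕ).prev n) n b = x a := by
      intro a
      obtain ⟨f, hf⟩ : ∃ f : P.complex.X n ⟶ Y, f = x a := ⟨_, rfl⟩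
      have h1 : P.complex.d (n + 1) n ≫ f = 0 := hf ▸ congr($hx a)
      have h2 := h (P.extMk f (n + 1) rfl h1)
      rw [ProjectiveResolution.mk₀_comp_extMk _ _ _ _ φ,
        ProjectiveResolution.extMk_eq_zero_iff_exists_prev,
        ProjectiveResolution.extMk_eq_zero_iff_exists_prev, hf] at h2
      exact h2 ⟨y a, congr($hxy a).symm⟩
    obtain ⟨l, hl⟩ := Module.projective_lifting_property
      ((P.complex.linearYonedaObj R Y).d ((ComplexShape.up ℕ).prev n) n).hom.rangeRestrict
      ((x.hom.codRestrict _ hr).comp (Projective.π A).hom) (LinearMap.surjective_rangeRestrict _)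
    refine ⟨_, Projective.π A, inferInstance, ModuleCat.ofHom l, ?_⟩
    ext a
    exact congr(($hl a).1).symm
  have h1 := HomologicalComplex.homologyOp_hom_naturality ψ n
  have h2 := ProjectiveResolution.isoLeftDerivedObj_hom_naturality g P' P φ.hom
    φ.hom_f_zero_comp_π_f_zero F n
  have h3 : Epi (HomologicalComplex.homologyMap
      ((HomologicalComplex.opFunctor _ _).map ψ.op) n) := by
    have h5 : Epi ((HomologicalComplex.homologyOp (P'.complex.linearYonedaObj R Y) n).hom ≫
        (HomologicalComplex.homologyMap ψ n).op) := inferInstance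
    rw [← h1] at h5
    exact epi_of_epi_comp_iso_hom _ _ h5
  have h4 : Epi ((F.mapHomologicalComplex (ComplexShape.down ℕ) ⋙
      HomologicalComplex.homologyFunctor _ _ n).map φ.hom) := h3
  have h5 : Epi ((F.leftDerived n).map g ≫ (P.isoLeftDerivedObj F n).hom) := by
    rw [h2]
    infer_instance
  exact (epi_comp_iff_of_isIso _ _).1 h5

end

section
open CategoryTheory Limits
variable {R : Type} [CommRing R]
variable {J : Type} [SmallCategory J]

lemma subsingleton_colimit_of_forall [IsFiltered J] (F : J ⥤ ModuleCat.{0} R)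
    (h : ∀ j, Subsingleton (F.obj j)) : Subsingleton (colimit F : ModuleCat.{0} R) := by
  refine subsingleton_of_forall_eq 0 fun x ↦ ?_
  obtain ⟨j, y, rfl⟩ := Concrete.colimit_exists_rep F x
  rw [Subsingleton.elim y 0, map_zero]

lemma nontrivial_colimit_of_mono [IsFiltered J] (F : J ⥤ ModuleCat.{0} R) (j : J)
    [Nontrivial (F.obj j)] (h : ∀ (i : J) (f : j ⟶ i), Mono (F.map f)) :
    Nontrivial (colimit F : ModuleCat.{0} R) := by
  obtain ⟨x, hx⟩ := exists_ne (0 : F.obj j)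
  refine ⟨colimit.ι F j x, 0, fun h0 ↦ hx ?_⟩
  obtain ⟨i, f, hfg⟩ := Concrete.colimit_rep_eq_zero _ F j x h0
  exact (ModuleCat.mono_iff_injective _).1 (h i f) (by rw [hfg, map_zero])

/-- Local cohomology with support in `I` is the colimit of `Extⁱ(R/Iᵗ, M)`. -/
noncomputable def localCohomologyObjIso (I : Ideal R) (i : ℕ) (M : ModuleCat.{0} R) :
    (localCohomology I i).obj M ≅
      colimit (localCohomology.diagram (localCohomology.idealPowersDiagram I) i ⋙
        (evaluation _ _).obj M) :=
  haveI := localCohomology.hasColimitDiagram.{0, 0} (localCohomology.idealPowersDiagram I) i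
  colimitObjIsoColimitCompEvaluation _ _

/-- The least `i` with `Extⁱ(R/m, M) ≠ 0` is `d`. -/
def HasExtDepth (m : Ideal R) (M : Type) [AddCommGroup M] [Module R M] (d : ℕ) : Prop :=
  (∀ i < d, Subsingleton (Abelian.Ext (ModuleCat.of R (R ⧸ m)) (ModuleCat.of R M) i)) ∧
    Nontrivial (Abelian.Ext (ModuleCat.of R (R ⧸ m)) (ModuleCat.of R M) d)

variable {m : Ideal R} {M N : Type} [AddCommGroup M] [Module R M] [AddCommGroup N] [Module R N]

lemma support_quotient_pow_subset (m : Ideal R) (t : ℕ) :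
    Module.support R (R ⧸ m ^ t) ⊆ PrimeSpectrum.zeroLocus m := by
  rw [Module.support_eq_zeroLocus, Ideal.annihilator_quotient,
    PrimeSpectrum.zeroLocus_subset_zeroLocus_iff]
  exact fun x hx ↦ ⟨t, Ideal.pow_mem_pow hx t⟩

namespace HasExtDepth

lemma subsingleton_ext [IsNoetherianRing R] [Module.Finite R M] {d : ℕ} (h : HasExtDepth m M d)
    (hm : m • (⊤ : Submodule R M) ≠ ⊤) (X : Type) [AddCommGroup X] [Module R X]
    [Module.Finite R X] (hX : Module.support R X ⊆ PrimeSpectrum.zeroLocus m) (i : ℕ) (hi : i < d) :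
    Subsingleton (Abelian.Ext (ModuleCat.of R X) (ModuleCat.of R M) i) := by
  obtain ⟨rs, hlen, hmem, hreg⟩ := ModuleCat.exists_isRegular_of_exists_subsingleton_ext m d
    (ModuleCat.of R M) hm.lt_top (ModuleCat.of R (R ⧸ m))
    (by simp [Module.support_eq_zeroLocus, Ideal.annihilator_quotient]) h.1
  exact ModuleCat.subsingleton_ext_of_exists_isRegular m (ModuleCat.of R X) hX
    (ModuleCat.of R M) hm.lt_top rs hmem hreg i (hlen ▸ hi)

lemma subsingleton_localCohomology [IsNoetherianRing R] [Module.Finite R M] {d : ℕ}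
    (h : HasExtDepth m M d) (hm : m • (⊤ : Submodule R M) ≠ ⊤) (i : ℕ) (hi : i < d) :
    Subsingleton ((localCohomology m i).obj (ModuleCat.of R M)) := by
  rw [((localCohomologyObjIso m i _).toLinearEquiv).toEquiv.subsingleton_congr]
  apply subsingleton_colimit_of_forall
  intro j
  rw [← not_nontrivial_iff_subsingleton]
  erw [nontrivial_ext_iff]
  rw [not_nontrivial_iff_subsingleton]
  exact h.subsingleton_ext hm _ (support_quotient_pow_subset m _) i hi

lemma nontrivial_localCohomology [IsNoetherianRing R] [Module.Finite R M] {d : ℕ}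
    (h : HasExtDepth m M d) (hm : m • (⊤ : Submodule R M) ≠ ⊤) :
    Nontrivial ((localCohomology m d).obj (ModuleCat.of R M)) := by
  rw [((localCohomologyObjIso m d _).toLinearEquiv).toEquiv.nontrivial_congr]
  let F := localCohomology.diagram (localCohomology.idealPowersDiagram m) d ⋙
        (evaluation _ _).obj (ModuleCat.of R M)
  have hnt : Nontrivial (F.obj (.op (.op 1))) := by
    change Nontrivial (((Ext R (ModuleCat.{0} R) d).obj (.op (.of R (R ⧸ m ^ 1)))).obj (.of R M))
    rw [pow_one, nontrivial_ext_iff]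
    exact h.2
  apply nontrivial_colimit_of_mono F (.op (.op 1))
  intro j f
  change Mono (((Ext R (ModuleCat.{0} R) d).map
    ((localCohomology.ringModIdeals (localCohomology.idealPowersDiagram m)).map f.unop).op).app _)
  apply mono_ext_map_app
  intro α hα
  generalize hg : ((localCohomology.ringModIdeals (localCohomology.idealPowersDiagram m)).map
    f.unop) = g at α hα
  have hgs : Function.Surjective g := by
    subst hg
    intro x
    obtain ⟨y, rfl⟩ := Submodule.Quotient.mk_surjective _ x
    exact ⟨Submodule.Quotient.mk y, rfl⟩
  have hge : Epi g := (ModuleCat.epi_iff_surjective _).2 hgs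
  cases d with
  | zero =>
    apply Abelian.Ext.precomp_mk₀_injective_of_epi _ g
    simpa using hα
  | succ d =>
    let S : ShortComplex (ModuleCat.{0} R) := ShortComplex.mk (ModuleCat.ofHom
      (LinearMap.ker g.hom).subtype) g (by ext x; exact x.2)
    have hS : S.ShortExact := by
      refine @ShortComplex.ShortExact.mk _ _ _ S ?_ ?_ hge
      · rw [ShortComplex.moduleCat_exact_iff]
        exact fun x hx ↦ ⟨⟨x, hx⟩, rfl⟩
      · exact (ModuleCat.mono_iff_injective _).2 Subtype.val_injective
    obtain ⟨x₁, hx₁⟩ := Abelian.Ext.contravariant_sequence_exact₃ hS _ α hα (n₀ := d) (by lia)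
    have : Module.Finite R (R ⧸ m ^ (Opposite.unop (Opposite.unop j))) := inferInstance
    have hfin : Module.Finite R ((localCohomology.ringModIdeals
      (localCohomology.idealPowersDiagram m)).obj (Opposite.unop j)) := this
    have : Subsingleton (Abelian.Ext S.X₁ (ModuleCat.of R M) d) := by
      refine h.subsingleton_ext hm (LinearMap.ker g.hom) ?_ d (by lia)
      refine Set.Subset.trans (Module.support_subset_of_injective
        (LinearMap.ker g.hom).subtype Subtype.val_injective) ?_
      exact support_quotient_pow_subset m _
    rw [← hx₁, Subsingleton.elim x₁ 0, Abelian.Ext.comp_zero]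

lemma sInf_localCohomology [IsNoetherianRing R] [Module.Finite R M] {d : ℕ}
    (h : HasExtDepth m M d) (hm : m • (⊤ : Submodule R M) ≠ ⊤) :
    sInf {i : ℕ | Nontrivial ((localCohomology m i).obj (ModuleCat.of R M))} = d := by
  refine le_antisymm (Nat.sInf_le (h.nontrivial_localCohomology hm)) ?_
  refine le_csInf ⟨d, h.nontrivial_localCohomology hm⟩ fun i hi ↦ ?_
  by_contra! hlt
  exact not_subsingleton_iff_nontrivial.2 hi (h.subsingleton_localCohomology hm i hlt)

end HasExtDepth

end

section
open CategoryTheory Limits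
variable {R : Type} [CommRing R]
variable {m : Ideal R} {L M N X : Type} [AddCommGroup M] [Module R M] [AddCommGroup N] [Module R N]
  [AddCommGroup L] [Module R L] [AddCommGroup X] [Module R X]

lemma nontrivial_ext_of_retract (s : M →ₗ[R] N) (p : N →ₗ[R] M) (h : p ∘ₗ s = LinearMap.id)
    (i : ℕ) (hM : Nontrivial (Abelian.Ext (ModuleCat.of R X) (ModuleCat.of R M) i)) :
    Nontrivial (Abelian.Ext (ModuleCat.of R X) (ModuleCat.of R N) i) := by
  obtain ⟨α, hα⟩ := exists_ne (0 : Abelian.Ext (ModuleCat.of R X) (ModuleCat.of R M) i)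
  refine ⟨α.comp (Abelian.Ext.mk₀ (ModuleCat.ofHom s)) (add_zero i), 0, fun h0 ↦ hα ?_⟩
  have h1 := congr(Abelian.Ext.comp $h0 (Abelian.Ext.mk₀ (ModuleCat.ofHom p)) (add_zero i))
  rwa [Abelian.Ext.comp_assoc_of_third_deg_zero, Abelian.Ext.mk₀_comp_mk₀, ← ModuleCat.ofHom_comp,
    h, ModuleCat.ofHom_id, Abelian.Ext.comp_mk₀_id, Abelian.Ext.zero_comp] at h1

lemma subsingleton_ext_of_sum_eq_id {ι : Type} [Fintype ι] {T : ι → Type}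
    [∀ i, AddCommGroup (T i)] [∀ i, Module R (T i)] (s : ∀ i, T i →ₗ[R] L) (p : ∀ i, L →ₗ[R] T i)
    (h : ∑ i, s i ∘ₗ p i = LinearMap.id) (n : ℕ)
    (hT : ∀ i, Subsingleton (Abelian.Ext (ModuleCat.of R X) (ModuleCat.of R (T i)) n)) :
    Subsingleton (Abelian.Ext (ModuleCat.of R X) (ModuleCat.of R L) n) := by
  refine subsingleton_of_forall_eq 0 fun α ↦ ?_
  have h1 : 𝟙 (ModuleCat.of R L) = ∑ i, ModuleCat.ofHom (p i) ≫ ModuleCat.ofHom (s i) := by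
    ext x
    simpa [ModuleCat.hom_sum] using congr($h.symm x)
  rw [← Abelian.Ext.comp_mk₀_id α, h1, Abelian.Ext.mk₀_sum, Abelian.Ext.comp_sum]
  refine Finset.sum_eq_zero fun i _ ↦ ?_
  rw [← Abelian.Ext.mk₀_comp_mk₀, ← Abelian.Ext.comp_assoc_of_third_deg_zero,
    Subsingleton.elim (α.comp (Abelian.Ext.mk₀ (ModuleCat.ofHom (p i))) (add_zero n)) 0,
    Abelian.Ext.zero_comp]

variable (M) in
lemma quotSMulTop_ext_subsingleton_iff {x : R} (hx : IsSMulRegular M x)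
    (hX : x ∈ Module.annihilator R X) (i : ℕ) :
    Subsingleton (Abelian.Ext (ModuleCat.of R X) (ModuleCat.of R (QuotSMulTop x M)) i) ↔
      Subsingleton (Abelian.Ext (ModuleCat.of R X) (ModuleCat.of R M) i) ∧
      Subsingleton (Abelian.Ext (ModuleCat.of R X) (ModuleCat.of R M) (i + 1)) := by
  let S := (ModuleCat.of R M).smulShortComplex x
  have hS : S.ShortExact := IsSMulRegular.smulShortComplex_shortExact (M := ModuleCat.of R M) hx
  have h0 (j : ℕ) (α : Abelian.Ext (ModuleCat.of R X) (ModuleCat.of R M) j) :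
      α.comp (Abelian.Ext.mk₀ S.f) (add_zero j) = 0 :=
    congr($(Abelian.Ext.postcomp_smul_id_eq_zero_of_mem_annihilator (M := ModuleCat.of R M)
      (N := ModuleCat.of R X) hX j) α)
  constructor
  · intro h
    constructor
    · refine subsingleton_of_forall_eq 0 fun α ↦ ?_
      obtain ⟨β, rfl⟩ := Abelian.Ext.covariant_sequence_exact₂ (ModuleCat.of R X) hS α
        (@Subsingleton.elim _ h _ _)
      exact h0 _ _
    · refine subsingleton_of_forall_eq 0 fun α ↦ ?_
      obtain ⟨β, rfl⟩ := Abelian.Ext.covariant_sequence_exact₁ (ModuleCat.of R X) hS α (h0 _ _) rfl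
      have hβ : β = 0 := @Subsingleton.elim _ h _ _
      rw [hβ, Abelian.Ext.zero_comp]
      rfl
  · rintro ⟨h1, h2⟩
    refine subsingleton_of_forall_eq 0 fun α ↦ ?_
    obtain ⟨β, rfl⟩ := Abelian.Ext.covariant_sequence_exact₃ (ModuleCat.of R X) hS α rfl
      (@Subsingleton.elim _ h2 _ _)
    have hβ : β = 0 := @Subsingleton.elim _ h1 _ _
    rw [hβ, Abelian.Ext.zero_comp]
    rfl

lemma subsingleton_ext_zero_iff :
    Subsingleton (Abelian.Ext (ModuleCat.of R X) (ModuleCat.of R M) 0) ↔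
      Subsingleton (X →ₗ[R] M) :=
  (Abelian.Ext.addEquiv₀.trans ModuleCat.homAddEquiv).toEquiv.subsingleton_congr

lemma mem_annihilator_quotient {x : R} (hx : x ∈ m) : x ∈ Module.annihilator R (R ⧸ m) := by
  rwa [Ideal.annihilator_quotient]

namespace HasExtDepth

lemma of_equiv (e : M ≃ₗ[R] N) {d : ℕ} (h : HasExtDepth m M d) : HasExtDepth m N d := by
  refine ⟨fun i hi ↦ ?_, nontrivial_ext_of_retract e.toLinearMap e.symm.toLinearMap
    (by ext; simp) d h.2⟩
  by_contra! hn
  exact not_subsingleton_iff_nontrivial.2 (nontrivial_ext_of_retract e.symm.toLinearMap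
    e.toLinearMap (by ext; simp) i hn) (h.1 i hi)

lemma of_pi_equiv {ι : Type} [Fintype ι] {T : ι → Type} [∀ i, AddCommGroup (T i)]
    [∀ i, Module R (T i)] (e : L ≃ₗ[R] (∀ i, T i)) {δ : ι → ℕ} (hT : ∀ i, HasExtDepth m (T i) (δ i))
    (i₀ : ι) (hi₀ : ∀ i, δ i₀ ≤ δ i) : HasExtDepth m L (δ i₀) := by
  classical
  constructor
  · intro n hn
    refine subsingleton_ext_of_sum_eq_id (fun i ↦ e.symm.toLinearMap ∘ₗ LinearMap.single R T i)
      (fun i ↦ LinearMap.proj i ∘ₗ e.toLinearMap) ?_ n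
      fun i ↦ (hT i).1 n (hn.trans_le (hi₀ i))
    ext x
    apply e.injective
    simp only [LinearMap.coe_sum, Finset.sum_apply, LinearMap.comp_apply, map_sum,
      LinearEquiv.coe_coe, LinearEquiv.apply_symm_apply, LinearMap.proj_apply]
    simpa using LinearMap.sum_single_apply T (e x)
  · exact nontrivial_ext_of_retract (e.symm.toLinearMap ∘ₗ LinearMap.single R T i₀)
      (LinearMap.proj i₀ ∘ₗ e.toLinearMap) (by ext; simp) _ (hT i₀).2

lemma zero_iff : HasExtDepth m M 0 ↔ ∃ x : M, x ≠ 0 ∧ ∀ a ∈ m, a • x = 0 := by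
  have : HasExtDepth m M 0 ↔ Nontrivial ((R ⧸ m) →ₗ[R] M) := by
    rw [← not_subsingleton_iff_nontrivial, ← subsingleton_ext_zero_iff,
      not_subsingleton_iff_nontrivial, HasExtDepth]
    simp
  rw [this]
  constructor
  · intro h
    obtain ⟨f, hf⟩ := exists_ne (0 : (R ⧸ m) →ₗ[R] M)
    refine ⟨f (Submodule.Quotient.mk 1), fun h0 ↦ hf ?_, fun a ha ↦ ?_⟩
    · ext
      simpa using h0
    · rw [← map_smul, ← Submodule.Quotient.mk_smul, (Submodule.Quotient.mk_eq_zero m).2 (by simpa),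
        map_zero]
  · rintro ⟨x, hx, hm⟩
    refine ⟨Submodule.liftQ m (LinearMap.toSpanSingleton R M x) fun a ha ↦ hm a ha, 0,
      fun h ↦ hx ?_⟩
    have h1 : (LinearMap.toSpanSingleton R M x) 1 = 0 := congr($h (Submodule.Quotient.mk 1))
    simpa using h1

lemma exists_isSMulRegular [IsNoetherianRing R] [Module.Finite R M]
    (h : Subsingleton (Abelian.Ext (ModuleCat.of R (R ⧸ m)) (ModuleCat.of R M) 0)) :
    ∃ x ∈ m, IsSMulRegular M x := by
  rw [subsingleton_ext_zero_iff] at h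
  obtain ⟨x, hx, hreg⟩ := IsSMulRegular.subsingleton_linearMap_iff.1 h
  exact ⟨x, by rwa [Ideal.annihilator_quotient] at hx, hreg⟩

lemma quotSMulTop_iff {x : R} (hxm : x ∈ m) (hx : IsSMulRegular M x) {d : ℕ} :
    HasExtDepth m (QuotSMulTop x M) d ↔ HasExtDepth m M (d + 1) := by
  have key := quotSMulTop_ext_subsingleton_iff M hx (mem_annihilator_quotient hxm)
  have h0 : Subsingleton (Abelian.Ext (ModuleCat.of R (R ⧸ m)) (ModuleCat.of R M) 0) :=
    subsingleton_ext_zero_iff.2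
      (IsSMulRegular.linearMap_subsingleton_of_mem_annihilator hx (mem_annihilator_quotient hxm))
  constructor
  · rintro ⟨h1, h2⟩
    have h3 : ∀ i < d + 1, Subsingleton
        (Abelian.Ext (ModuleCat.of R (R ⧸ m)) (ModuleCat.of R M) i) := by
      intro i hi
      cases i with
      | zero => exact h0
      | succ j => exact ((key j).1 (h1 j (by lia))).2
    refine ⟨h3, ?_⟩
    by_contra! hn
    exact not_subsingleton_iff_nontrivial.2 h2 ((key d).2 ⟨h3 d (by lia), hn⟩)
  · rintro ⟨h1, h2⟩
    refine ⟨fun i hi ↦ (key i).2 ⟨h1 i (by lia), h1 _ (by lia)⟩, ?_⟩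
    by_contra! hn
    exact not_subsingleton_iff_nontrivial.2 h2 ((key d).1 hn).2

lemma of_exact {f : L →ₗ[R] M} {g : M →ₗ[R] N} (hf : Function.Injective f)
    (hg : Function.Surjective g) (hfg : Function.Exact f g) {d : ℕ} (hL : HasExtDepth m L d)
    (hN : ∀ i < d, Subsingleton (Abelian.Ext (ModuleCat.of R (R ⧸ m)) (ModuleCat.of R N) i)) :
    HasExtDepth m M d := by
  let S : ShortComplex (ModuleCat.{0} R) := ShortComplex.mk (ModuleCat.ofHom f) (ModuleCat.ofHom g)
    (by ext x; exact hfg.apply_apply_eq_zero x)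
  have hS : S.ShortExact := by
    refine @ShortComplex.ShortExact.mk _ _ _ S ?_ ?_ ?_
    · rw [ShortComplex.moduleCat_exact_iff]
      exact fun x hx ↦ (hfg x).1 hx
    · exact (ModuleCat.mono_iff_injective _).2 hf
    · exact (ModuleCat.epi_iff_surjective _).2 hg
  constructor
  · intro i hi
    refine subsingleton_of_forall_eq 0 fun α ↦ ?_
    obtain ⟨β, rfl⟩ := Abelian.Ext.covariant_sequence_exact₂ (ModuleCat.of R (R ⧸ m)) hS α
      (@Subsingleton.elim _ (hN i hi) _ _)
    rw [@Subsingleton.elim _ (hL.1 i hi) β 0, Abelian.Ext.zero_comp]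
  · have := hL.2
    obtain ⟨α, hα⟩ := exists_ne
      (0 : Abelian.Ext (ModuleCat.of R (R ⧸ m)) (ModuleCat.of R L) d)
    refine ⟨α.comp (Abelian.Ext.mk₀ S.f) (add_zero d), 0, fun h0 ↦ hα ?_⟩
    cases d with
    | zero =>
      have := hS.mono_f
      apply Abelian.Ext.postcomp_mk₀_injective_of_mono _ S.f
      simpa using h0
    | succ d =>
      obtain ⟨β, rfl⟩ := Abelian.Ext.covariant_sequence_exact₁ _ hS α h0 rfl
      rw [@Subsingleton.elim _ (hN d (by lia)) β 0, Abelian.Ext.zero_comp]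

lemma exists_of_nontrivial_ext {d : ℕ}
    (h : Nontrivial (Abelian.Ext (ModuleCat.of R (R ⧸ m)) (ModuleCat.of R M) d)) :
    ∃ d, HasExtDepth m M d := by
  classical
  have hex : ∃ d, Nontrivial (Abelian.Ext (ModuleCat.of R (R ⧸ m)) (ModuleCat.of R M) d) := ⟨d, h⟩
  exact ⟨Nat.find hex, fun i hi ↦ not_nontrivial_iff_subsingleton.1 (Nat.find_min hex hi),
    Nat.find_spec hex⟩

lemma exists_quotSMulTop_equiv [Module.Finite R M] {K : Submodule R M} (hK : K ⊔ m • ⊤ ≠ ⊤)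
    {x : R} (hxm : x ∈ m) (hx : IsSMulRegular (M ⧸ K) x) :
    ∃ K' : Submodule R M, K < K' ∧ K' ⊔ m • ⊤ ≠ ⊤ ∧
      Nonempty ((M ⧸ K') ≃ₗ[R] QuotSMulTop x (M ⧸ K)) := by
  let φ : M →ₗ[R] QuotSMulTop x (M ⧸ K) := (Submodule.mkQ _) ∘ₗ K.mkQ
  have hφ : Function.Surjective φ :=
    (Submodule.mkQ_surjective _).comp (Submodule.mkQ_surjective _)
  have hmem (y : M) : y ∈ LinearMap.ker φ ↔ ∃ z, y - x • z ∈ K := by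
    change Submodule.Quotient.mk _ = 0 ↔ _
    rw [Submodule.Quotient.mk_eq_zero, Submodule.mem_smul_pointwise_iff_exists]
    constructor
    · rintro ⟨w, -, hw⟩
      obtain ⟨z, rfl⟩ := K.mkQ_surjective w
      refine ⟨z, ?_⟩
      rw [← K.ker_mkQ, LinearMap.mem_ker, map_sub, map_smul, hw, sub_self]
    · rintro ⟨z, hz⟩
      refine ⟨K.mkQ z, trivial, ?_⟩
      rwa [← K.ker_mkQ, LinearMap.mem_ker, map_sub, map_smul, sub_eq_zero, eq_comm] at hz
  refine ⟨LinearMap.ker φ, lt_of_le_of_ne (fun y hy ↦ (hmem y).2 ⟨0, by simpa⟩) ?_, ?_,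
    ⟨LinearMap.quotKerEquivOfSurjective φ hφ⟩⟩
  · refine fun heq ↦ hK (eq_top_iff.2 fun z _ ↦ Submodule.mem_sup_left ?_)
    have h1 : x • z ∈ K := by
      rw [heq]
      exact (hmem _).2 ⟨z, by simp⟩
    rw [← K.ker_mkQ, LinearMap.mem_ker] at h1 ⊢
    exact hx (by simpa using h1)
  · refine fun h ↦ hK (eq_top_iff.2 (h.symm.trans_le (sup_le (fun y hy ↦ ?_) le_sup_right)))
    obtain ⟨z, hz⟩ := (hmem y).1 hy
    have hxz : x • z ∈ m • (⊤ : Submodule R M) := Submodule.smul_mem_smul hxm trivial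
    simpa using Submodule.add_mem_sup hz hxz

variable (m M) in
lemma exists_of_smul_top_ne_top [IsNoetherianRing R] [Module.Finite R M]
    (hm : m • (⊤ : Submodule R M) ≠ ⊤) : ∃ d, HasExtDepth m M d := by
  suffices H : ∀ K : Submodule R M, K ⊔ m • ⊤ ≠ ⊤ → ∃ d, HasExtDepth m (M ⧸ K) d by
    obtain ⟨d, hd⟩ := H ⊥ (by simpa)
    exact ⟨d, hd.of_equiv (Submodule.quotEquivOfEqBot ⊥ rfl)⟩
  intro K
  induction K using WellFoundedGT.induction with
  | ind K ih =>
  intro hK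
  by_cases h0 : Subsingleton (Abelian.Ext (ModuleCat.of R (R ⧸ m)) (ModuleCat.of R (M ⧸ K)) 0)
  · obtain ⟨x, hxm, hx⟩ := exists_isSMulRegular h0
    obtain ⟨K', hlt, hK', ⟨e⟩⟩ := exists_quotSMulTop_equiv hK hxm hx
    obtain ⟨d, hd⟩ := ih K' hlt hK'
    exact ⟨d + 1, (quotSMulTop_iff hxm hx).1 (hd.of_equiv e)⟩
  · exact exists_of_nontrivial_ext (not_subsingleton_iff_nontrivial.1 h0)

end HasExtDepth

end

section
open TensorProduct
open scoped Pointwise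
variable {k A B R : Type} [Field k] [CommRing A] [CommRing B] [CommRing R] [Algebra k A]
  [Algebra k B] [Algebra k R]

namespace IsTensorProduct

section
variable {M N T : Type} [AddCommGroup M] [AddCommGroup N] [AddCommGroup T] [Module k M]
  [Module k N] [Module k T] {φ : M →ₗ[k] N →ₗ[k] T}

lemma flip (hφ : IsTensorProduct φ) : IsTensorProduct φ.flip := by
  have : TensorProduct.lift φ.flip = TensorProduct.lift φ ∘ₗ (TensorProduct.comm k N M) := by
    ext; simp
  rw [IsTensorProduct, this, LinearMap.coe_comp]
  exact Function.Bijective.comp hφ (TensorProduct.comm k N M).bijective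

lemma apply_ne_zero (hφ : IsTensorProduct φ) {x : M} {y : N} (hx : x ≠ 0) (hy : y ≠ 0) :
    φ x y ≠ 0 := by
  obtain ⟨f, hf⟩ := not_forall.1 (mt (Module.forall_dual_apply_eq_zero_iff k x).1 hx)
  obtain ⟨g, hg⟩ := not_forall.1 (mt (Module.forall_dual_apply_eq_zero_iff k y).1 hy)
  intro h
  have h1 := hφ.lift_eq ((LinearMap.mul k k).compl₁₂ f g) x y
  rw [h, map_zero] at h1
  simp [hf, hg] at h1

end

section
variable {M N T : Type} [AddCommGroup M] [AddCommGroup N] [AddCommGroup T] [Module k M]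
  [Module k N] [Module k T] [Module A M] [IsScalarTower k A M] [Module R T]
  {φ : M →ₗ[k] N →ₗ[k] T} {f : A →ₐ[k] R}

lemma smul_lift (hA : ∀ (a : A) x y, φ (a • x) y = f a • φ x y) (a : A) (z : M ⊗[k] N) :
    TensorProduct.lift φ ((DistribSMul.toLinearMap k M a).rTensor N z) =
      f a • TensorProduct.lift φ z := by
  induction z with
  | zero => simp
  | tmul x y => simp [hA]
  | add x y hx hy => simp [hx, hy]

lemma isSMulRegular (hφ : IsTensorProduct φ)
    (hA : ∀ (a : A) x y, φ (a • x) y = f a • φ x y) {a : A} (ha : IsSMulRegular M a) :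
    IsSMulRegular T (f a) := by
  intro s t hst
  obtain ⟨s, rfl⟩ := hφ.2 s
  obtain ⟨t, rfl⟩ := hφ.2 t
  simp only [← smul_lift hA] at hst
  congr 1
  exact Module.Flat.rTensor_preserves_injective_linearMap (M := N)
    (DistribSMul.toLinearMap k M a) ha (hφ.1 hst)

variable [IsScalarTower k R T]

/-- The tensor product pairing induced on quotients by multiplication by `a`. -/
noncomputable def quotSMulTopMap (hA : ∀ (a : A) x y, φ (a • x) y = f a • φ x y) (a : A) :
    QuotSMulTop a M →ₗ[k] N →ₗ[k] QuotSMulTop (f a) T :=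
  Submodule.liftQ ((a • (⊤ : Submodule A M)).restrictScalars k)
    (LinearMap.compr₂ φ ((f a • (⊤ : Submodule R T)).mkQ.restrictScalars k))
    (by
      intro x hx
      obtain ⟨z, -, rfl⟩ := (Submodule.mem_smul_pointwise_iff_exists _ _ _).1 hx
      ext y
      refine (Submodule.Quotient.mk_eq_zero _).2 ?_
      rw [hA]
      exact Submodule.smul_mem_pointwise_smul _ _ _ trivial) ∘ₗ
    (Submodule.Quotient.restrictScalarsEquiv k (a • (⊤ : Submodule A M))).symm.toLinearMap

lemma quotSMulTopMap_mk (hA : ∀ (a : A) x y, φ (a • x) y = f a • φ x y) (a : A) (x : M) (y : N) :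
    quotSMulTopMap hA a (Submodule.Quotient.mk x) y = Submodule.Quotient.mk (φ x y) :=
  rfl

lemma quotSMulTop (hφ : IsTensorProduct φ) (hA : ∀ (a : A) x y, φ (a • x) y = f a • φ x y) (a : A) :
    IsTensorProduct (quotSMulTopMap hA a) := by
  let π : M →ₗ[k] QuotSMulTop a M := (a • (⊤ : Submodule A M)).mkQ.restrictScalars k
  have hπ : Function.Surjective (π.rTensor N) :=
    LinearMap.rTensor_surjective N (Submodule.mkQ_surjective (a • (⊤ : Submodule A M)))
  have hcomm : TensorProduct.lift (quotSMulTopMap hA a) ∘ₗ π.rTensor N =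
      ((f a • (⊤ : Submodule R T)).mkQ.restrictScalars k) ∘ₗ TensorProduct.lift φ := by
    ext x y
    rfl
  replace hcomm (z : M ⊗[k] N) : TensorProduct.lift (quotSMulTopMap hA a) (π.rTensor N z) =
      Submodule.Quotient.mk (TensorProduct.lift φ z) := congr($hcomm z)
  constructor
  · rw [injective_iff_map_eq_zero]
    intro z hz
    obtain ⟨z, rfl⟩ := hπ z
    rw [hcomm, Submodule.Quotient.mk_eq_zero, Submodule.mem_smul_pointwise_iff_exists] at hz
    obtain ⟨t, -, ht⟩ := hz
    obtain ⟨w, rfl⟩ := hφ.2 t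
    rw [← smul_lift hA] at ht
    rw [← hφ.1 ht, ← LinearMap.comp_apply, ← LinearMap.rTensor_comp]
    have : π ∘ₗ DistribSMul.toLinearMap k M a = 0 := by
      ext x
      exact (Submodule.Quotient.mk_eq_zero _).2 (Submodule.smul_mem_pointwise_smul _ _ _ trivial)
    rw [this]
    simp
  · intro t
    obtain ⟨t, rfl⟩ := Submodule.Quotient.mk_surjective _ t
    obtain ⟨w, rfl⟩ := hφ.2 t
    exact ⟨_, hcomm w⟩

lemma quotSMulTopMap_smul_left (hA : ∀ (a : A) x y, φ (a • x) y = f a • φ x y) (a : A)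
    (b : A) (x : QuotSMulTop a M) (y : N) :
    quotSMulTopMap hA a (b • x) y = f b • quotSMulTopMap hA a x y := by
  obtain ⟨x, rfl⟩ := Submodule.Quotient.mk_surjective _ x
  rw [← Submodule.Quotient.mk_smul, quotSMulTopMap_mk, quotSMulTopMap_mk, hA,
    Submodule.Quotient.mk_smul]

lemma quotSMulTopMap_smul_right [Module B N] {g : B →ₐ[k] R}
    (hA : ∀ (a : A) x y, φ (a • x) y = f a • φ x y)
    (hB : ∀ (b : B) x y, φ x (b • y) = g b • φ x y) (a : A)
    (b : B) (x : QuotSMulTop a M) (y : N) :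
    quotSMulTopMap hA a x (b • y) = g b • quotSMulTopMap hA a x y := by
  obtain ⟨x, rfl⟩ := Submodule.Quotient.mk_surjective _ x
  rw [quotSMulTopMap_mk, quotSMulTopMap_mk, hB, Submodule.Quotient.mk_smul]

end
end IsTensorProduct

/-- Depth is additive on tensor products over a field. -/
theorem HasExtDepth.tensor [IsNoetherianRing A] [IsNoetherianRing B] {f : A →ₐ[k] R} {g : B →ₐ[k] R}
    {mA : Ideal A} {mB : Ideal B} {a b : ℕ} {M N T : Type} [AddCommGroup M] [AddCommGroup N]
    [AddCommGroup T] [Module k M] [Module k N] [Module k T] [Module A M] [IsScalarTower k A M]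
    [Module B N] [IsScalarTower k B N] [Module R T] [IsScalarTower k R T]
    [Module.Finite A M] [Module.Finite B N] (φ : M →ₗ[k] N →ₗ[k] T)
    (hφ : IsTensorProduct φ) (hA : ∀ (a : A) x y, φ (a • x) y = f a • φ x y)
    (hB : ∀ (b : B) x y, φ x (b • y) = g b • φ x y)
    (hM : HasExtDepth mA M a) (hN : HasExtDepth mB N b) :
    HasExtDepth (mA.map f ⊔ mB.map g) T (a + b) := by
  induction a generalizing M T with
  | zero =>
    induction b generalizing N T with
    | zero =>
      obtain ⟨x, hx0, hx⟩ := HasExtDepth.zero_iff.1 hM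
      obtain ⟨y, hy0, hy⟩ := HasExtDepth.zero_iff.1 hN
      refine HasExtDepth.zero_iff.2 ⟨φ x y, hφ.apply_ne_zero hx0 hy0, fun r hr ↦ ?_⟩
      suffices H : mA.map f ⊔ mB.map g ≤ LinearMap.ker (LinearMap.toSpanSingleton R T (φ x y)) from
        H hr
      refine sup_le (Ideal.map_le_iff_le_comap.2 fun c hc ↦ ?_)
        (Ideal.map_le_iff_le_comap.2 fun c hc ↦ ?_)
      · simp [← hA, hx c hc]
      · simp [← hB, hy c hc]
    | succ b ih =>
      obtain ⟨y, hy, hreg⟩ := HasExtDepth.exists_isSMulRegular (hN.1 0 (by lia))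
      have hB' : ∀ (b : B) x y, φ.flip (b • x) y = g b • φ.flip x y := fun b x y ↦ hB b y x
      have hA' : ∀ (a : A) x y, φ.flip x (a • y) = f a • φ.flip x y := fun b x y ↦ hA b y x
      have hN' := (HasExtDepth.quotSMulTop_iff hy hreg).2 hN
      have := ih hN' (IsTensorProduct.quotSMulTopMap hB' y).flip (hφ.flip.quotSMulTop hB' y).flip
        (fun a x z ↦ IsTensorProduct.quotSMulTopMap_smul_right hB' hA' y a z x)
        (fun b x z ↦ IsTensorProduct.quotSMulTopMap_smul_left hB' y b z x)
      exact (HasExtDepth.quotSMulTop_iff (Ideal.mem_sup_right (Ideal.mem_map_of_mem _ hy))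
        (hφ.flip.isSMulRegular hB' hreg)).1 this
  | succ a ih =>
    obtain ⟨x, hx, hreg⟩ := HasExtDepth.exists_isSMulRegular (hM.1 0 (by lia))
    have hM' := (HasExtDepth.quotSMulTop_iff hx hreg).2 hM
    have := ih (IsTensorProduct.quotSMulTopMap hA x) (hφ.quotSMulTop hA x)
      (IsTensorProduct.quotSMulTopMap_smul_left hA x)
      (IsTensorProduct.quotSMulTopMap_smul_right hA hB x) hM'
    rw [Nat.add_right_comm]
    exact (HasExtDepth.quotSMulTop_iff (Ideal.mem_sup_left (Ideal.mem_map_of_mem _ hx))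
      (hφ.isSMulRegular hA hreg)).1 this

end

section
open TensorProduct
variable {k A B R : Type} [Field k] [CommRing A] [CommRing B] [CommRing R] [Algebra k A]
  [Algebra k B] [Algebra k R]

namespace IsTensorProduct
variable {M N T U V : Type} [AddCommGroup M] [AddCommGroup N] [AddCommGroup T] [Module k M]
  [Module k N] [Module k T] [Module R T] [IsScalarTower k R T] [AddCommGroup U] [AddCommGroup V]
  [Module k U] [Module k V] {ψ : M →ₗ[k] N →ₗ[k] T} (α : U →ₗ[k] M) (β : V →ₗ[k] N)

/-- The restriction of a bilinear map to subspaces. -/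
def restrictMap (ψ : M →ₗ[k] N →ₗ[k] T) (W : Submodule R T) (hW : ∀ u v, ψ (α u) (β v) ∈ W) :
    U →ₗ[k] V →ₗ[k] W :=
  LinearMap.mk₂ k (fun u v ↦ ⟨ψ (α u) (β v), hW u v⟩)
    (by intros; ext; simp) (by intros; ext; simp) (by intros; ext; simp) (by intros; ext; simp)

lemma restrict (hψ : IsTensorProduct ψ) (hα : Function.Injective α) (hβ : Function.Injective β)
    (W : Submodule R T) (hW : ∀ u v, ψ (α u) (β v) ∈ W)
    (hspan : ∀ w ∈ W, w ∈ Submodule.span k {x | ∃ u v, ψ (α u) (β v) = x}) :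
    IsTensorProduct (restrictMap α β ψ W hW) := by
  have key : W.subtype.restrictScalars k ∘ₗ TensorProduct.lift (restrictMap α β ψ W hW) =
      TensorProduct.lift ψ ∘ₗ TensorProduct.map α β := by
    ext
    rfl
  constructor
  · have : Function.Injective (W.subtype.restrictScalars k ∘ₗ
        TensorProduct.lift (restrictMap α β ψ W hW)) := by
      rw [key]
      exact hψ.1.comp (TensorProduct.map_injective_of_flat_flat α β hα hβ)
    rw [LinearMap.coe_comp] at this
    exact Function.Injective.of_comp this
  · rintro ⟨w, hw⟩
    have hle : Submodule.span k {x | ∃ u v, ψ (α u) (β v) = x} ≤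
        LinearMap.range (TensorProduct.lift ψ ∘ₗ TensorProduct.map α β) := by
      rw [Submodule.span_le]
      rintro _ ⟨u, v, rfl⟩
      exact ⟨u ⊗ₜ v, rfl⟩
    obtain ⟨z, hz⟩ := hle (hspan w hw)
    rw [← key] at hz
    exact ⟨z, Subtype.ext hz⟩

end IsTensorProduct

variable {f : A →ₐ[k] R} {g : B →ₐ[k] R}

lemma mem_span_of_mem_map_mul_map
    (hfg : Function.Bijective (Algebra.TensorProduct.productMap f g)) (P : Ideal A) (Q : Ideal B)
    {r : R} (hr : r ∈ P.map f * Q.map g) :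
    r ∈ Submodule.span k {x | ∃ a ∈ P, ∃ b ∈ Q, f a * g b = x} := by
  rw [Ideal.map, Ideal.map, Ideal.span_mul_span'] at hr
  induction hr using Submodule.span_induction with
  | mem x hx =>
    obtain ⟨_, ⟨a, ha, rfl⟩, _, ⟨b, hb, rfl⟩, rfl⟩ := hx
    exact Submodule.subset_span ⟨a, ha, b, hb, rfl⟩
  | zero => exact zero_mem _
  | add x y _ _ hx hy => exact add_mem hx hy
  | smul r x hx' hx =>
    clear hx'
    obtain ⟨w, rfl⟩ := hfg.2 r
    induction w with
    | zero => simp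
    | add w z hw hz =>
      rw [map_add, add_smul]
      exact add_mem hw hz
    | tmul c d =>
      induction hx using Submodule.span_induction with
      | mem x hx =>
        obtain ⟨a, ha, b, hb, rfl⟩ := hx
        refine Submodule.subset_span ⟨c * a, P.mul_mem_left _ ha, d * b, Q.mul_mem_left _ hb, ?_⟩
        simp only [map_mul, Algebra.TensorProduct.productMap_apply_tmul, smul_eq_mul]
        ring
      | zero => simp
      | add x y _ _ hx hy =>
        rw [smul_add]
        exact add_mem hx hy
      | smul s x _ hx =>
        rw [smul_comm]
        exact Submodule.smul_mem _ _ hx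

lemma mul_mem_map_mul_map {P : Ideal A} {Q : Ideal B} {a : A} {b : B} (ha : a ∈ P) (hb : b ∈ Q) :
    f a * g b ∈ P.map f * Q.map g :=
  Ideal.mul_mem_mul (Ideal.mem_map_of_mem _ ha) (Ideal.mem_map_of_mem _ hb)

lemma exists_linearMap_retraction (P : Ideal A) :
    ∃ p : A →ₗ[k] A, (∀ a, p a ∈ P) ∧ ∀ a ∈ P, p a = a := by
  obtain ⟨s, hs⟩ := LinearMap.exists_leftInverse_of_injective (P.subtype.restrictScalars k)
    (LinearMap.ker_eq_bot.2 Subtype.val_injective)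
  exact ⟨(P.subtype.restrictScalars k) ∘ₗ s, fun a ↦ (s a).2,
    fun a ha ↦ congr(($hs ⟨a, ha⟩).1)⟩

lemma map_inf_map_le_mul
    (hfg : Function.Bijective (Algebra.TensorProduct.productMap f g)) (P : Ideal A) (Q : Ideal B) :
    P.map f ⊓ Q.map g ≤ P.map f * Q.map g := by
  rintro x ⟨hxP, hxQ⟩
  obtain ⟨p, hp, hp'⟩ := exists_linearMap_retraction (k := k) P
  obtain ⟨q, hq, hq'⟩ := exists_linearMap_retraction (k := k) Q
  let e : A ⊗[k] B ≃ₗ[k] R := LinearEquiv.ofBijective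
    (Algebra.TensorProduct.productMap f g).toLinearMap hfg
  have he (a b) : e.symm (f a * g b) = a ⊗ₜ b := by
    rw [LinearEquiv.symm_apply_eq]
    exact (Algebra.TensorProduct.productMap_apply_tmul f g a b).symm
  have h1 : e (TensorProduct.map p .id (e.symm x)) = x := by
    have hx : x ∈ P.map f * (⊤ : Ideal B).map g := by rwa [Ideal.map_top, Ideal.mul_top]
    have := LinearMap.eqOn_span (R := k) (f := e.toLinearMap ∘ₗ TensorProduct.map p .id ∘ₗ
      e.symm.toLinearMap) (g := LinearMap.id) ?_ (mem_span_of_mem_map_mul_map hfg _ _ hx)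
    · exact this
    · rintro _ ⟨a, ha, b, -, rfl⟩
      simp only [LinearMap.comp_apply, LinearEquiv.coe_coe, he, TensorProduct.map_tmul, hp' a ha]
      exact Algebra.TensorProduct.productMap_apply_tmul f g a b
  have h2 : e (TensorProduct.map .id q (e.symm x)) = x := by
    have hx : x ∈ (⊤ : Ideal A).map f * Q.map g := by rwa [Ideal.map_top, Ideal.top_mul]
    have := LinearMap.eqOn_span (R := k) (f := e.toLinearMap ∘ₗ TensorProduct.map .id q ∘ₗ
      e.symm.toLinearMap) (g := LinearMap.id) ?_ (mem_span_of_mem_map_mul_map hfg _ _ hx)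
    · exact this
    · rintro _ ⟨a, -, b, hb, rfl⟩
      simp only [LinearMap.comp_apply, LinearEquiv.coe_coe, he, TensorProduct.map_tmul, hq' b hb]
      exact Algebra.TensorProduct.productMap_apply_tmul f g a b
  have h3 : e (TensorProduct.map p q (e.symm x)) = x := by
    rw [← h2] at h1
    rw [LinearEquiv.symm_apply_apply, ← LinearMap.comp_apply, ← TensorProduct.map_comp] at h1
    simpa [h2] using h1
  rw [← h3]
  generalize e.symm x = w
  induction w with
  | zero => simp
  | tmul a b =>
    rw [TensorProduct.map_tmul]
    exact (Algebra.TensorProduct.productMap_apply_tmul f g _ _).symm ▸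
      mul_mem_map_mul_map (hp a) (hq b)
  | add x y hx hy =>
    rw [map_add, map_add]
    exact add_mem hx hy

variable (f g) in
/-- The multiplication pairing `A/P × B/Q → R/(PR + QR)`. -/
noncomputable def quotientMulMap (P : Ideal A) (Q : Ideal B) :
    (A ⧸ P) →ₗ[k] (B ⧸ Q) →ₗ[k] (R ⧸ (P.map f ⊔ Q.map g)) :=
  (LinearMap.mul k (R ⧸ (P.map f ⊔ Q.map g))).compl₁₂
    (Ideal.quotientMapₐ (P.map f ⊔ Q.map g) f
      (Ideal.map_le_iff_le_comap.1 le_sup_left)).toLinearMap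
    (Ideal.quotientMapₐ (P.map f ⊔ Q.map g) g
      (Ideal.map_le_iff_le_comap.1 le_sup_right)).toLinearMap

lemma quotientMulMap_mk (P : Ideal A) (Q : Ideal B) (a : A) (b : B) :
    quotientMulMap f g P Q (Ideal.Quotient.mk P a) (Ideal.Quotient.mk Q b) =
      Ideal.Quotient.mk _ (f a * g b) :=
  rfl

lemma isTensorProduct_quotientMulMap
    (hfg : Function.Bijective (Algebra.TensorProduct.productMap f g)) (P : Ideal A) (Q : Ideal B) :
    IsTensorProduct (quotientMulMap f g P Q) := by
  let e : A ⊗[k] B ≃ₐ[k] R := AlgEquiv.ofBijective (Algebra.TensorProduct.productMap f g) hfg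
  have hef (a) : e.symm (f a) = a ⊗ₜ 1 := by
    rw [AlgEquiv.symm_apply_eq]
    simp [e]
  have heg (b) : e.symm (g b) = 1 ⊗ₜ b := by
    rw [AlgEquiv.symm_apply_eq]
    simp [e]
  let θ : R →ₐ[k] (A ⧸ P) ⊗[k] (B ⧸ Q) :=
    (Algebra.TensorProduct.map (Ideal.Quotient.mkₐ k P) (Ideal.Quotient.mkₐ k Q)).comp
      e.symm.toAlgHom
  have hθ : P.map f ⊔ Q.map g ≤ RingHom.ker θ := by
    refine sup_le (Ideal.map_le_iff_le_comap.2 fun a ha ↦ ?_)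
      (Ideal.map_le_iff_le_comap.2 fun b hb ↦ ?_)
    · have : Ideal.Quotient.mk P a = 0 := Ideal.Quotient.eq_zero_iff_mem.2 ha
      simp [θ, RingHom.mem_ker, hef, this]
    · have : Ideal.Quotient.mk Q b = 0 := Ideal.Quotient.eq_zero_iff_mem.2 hb
      simp [θ, RingHom.mem_ker, heg, this]
  let π : A ⊗[k] B →ₗ[k] (A ⧸ P) ⊗[k] (B ⧸ Q) :=
    (Algebra.TensorProduct.map (Ideal.Quotient.mkₐ k P) (Ideal.Quotient.mkₐ k Q)).toLinearMap
  have hπ : Function.Surjective π := TensorProduct.map_surjective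
    (g := (Ideal.Quotient.mkₐ k P).toLinearMap) (g' := (Ideal.Quotient.mkₐ k Q).toLinearMap)
    Ideal.Quotient.mk_surjective Ideal.Quotient.mk_surjective
  have hcomm : TensorProduct.lift (quotientMulMap f g P Q) ∘ₗ π =
      (Ideal.Quotient.mkₐ k (P.map f ⊔ Q.map g)).toLinearMap ∘ₗ e.toLinearMap := by
    ext a b
    simp [π, e, quotientMulMap_mk]
  replace hcomm (w) : TensorProduct.lift (quotientMulMap f g P Q) (π w) =
    Ideal.Quotient.mk (P.map f ⊔ Q.map g) (e w) := congr($hcomm w)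
  constructor
  · rw [injective_iff_map_eq_zero]
    intro z hz
    obtain ⟨w, rfl⟩ := hπ z
    rw [hcomm, Ideal.Quotient.eq_zero_iff_mem] at hz
    have := hθ hz
    simpa [θ, RingHom.mem_ker] using! this
  · intro x
    obtain ⟨r, rfl⟩ := Ideal.Quotient.mk_surjective x
    exact ⟨π (e.symm r), by rw [hcomm]; simp⟩

lemma hasExtDepth_map_mkQ_mul [IsNoetherianRing A] [IsNoetherianRing B]
    (hfg : Function.Bijective (Algebra.TensorProduct.productMap f g)) {mA : Ideal A} {mB : Ideal B}
    (P P' : Ideal A) (Q Q' : Ideal B) {a b : ℕ}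
    (hP : HasExtDepth mA (P ⧸ (Submodule.comap P.subtype P')) a)
    (hQ : HasExtDepth mB (Q ⧸ (Submodule.comap Q.subtype Q')) b) :
    HasExtDepth (mA.map f ⊔ mB.map g)
      (Submodule.map (Submodule.mkQ (P'.map f ⊔ Q'.map g)) (P.map f * Q.map g)) (a + b) := by
  let α : (P ⧸ (Submodule.comap P.subtype P')) →ₗ[A] A ⧸ P' := Submodule.mapQ _ _ P.subtype le_rfl
  let β : (Q ⧸ (Submodule.comap Q.subtype Q')) →ₗ[B] B ⧸ Q' := Submodule.mapQ _ _ Q.subtype le_rfl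
  have hα : Function.Injective α := by
    rw [← LinearMap.ker_eq_bot]
    simp [α, Submodule.mapQ, Submodule.ker_liftQ_eq_bot, LinearMap.ker_comp]
  have hβ : Function.Injective β := by
    rw [← LinearMap.ker_eq_bot]
    simp [β, Submodule.mapQ, Submodule.ker_liftQ_eq_bot, LinearMap.ker_comp]
  have hW : ∀ u v, quotientMulMap f g P' Q' (α u) (β v) ∈
      Submodule.map (Submodule.mkQ (P'.map f ⊔ Q'.map g)) (P.map f * Q.map g) := by
    intro u v
    obtain ⟨u, rfl⟩ := Submodule.Quotient.mk_surjective _ u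
    obtain ⟨v, rfl⟩ := Submodule.Quotient.mk_surjective _ v
    exact ⟨f u * g v, mul_mem_map_mul_map u.2 v.2, rfl⟩
  refine HasExtDepth.tensor (f := f) (g := g) _ ((isTensorProduct_quotientMulMap hfg P' Q').restrict
    (α.restrictScalars k) (β.restrictScalars k) hα hβ _ hW ?_) ?_ ?_ hP hQ
  · rintro _ ⟨r, hr, rfl⟩
    have h1 := Submodule.apply_mem_span_image_of_mem_span
      (Ideal.Quotient.mkₐ k (P'.map f ⊔ Q'.map g)).toLinearMap
      (mem_span_of_mem_map_mul_map hfg P Q hr)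
    refine Submodule.span_mono ?_ h1
    rintro _ ⟨_, ⟨a, ha, b, hb, rfl⟩, rfl⟩
    exact ⟨Submodule.Quotient.mk ⟨a, ha⟩, Submodule.Quotient.mk ⟨b, hb⟩, rfl⟩
  · intro c u v
    obtain ⟨u, rfl⟩ := Submodule.Quotient.mk_surjective _ u
    obtain ⟨v, rfl⟩ := Submodule.Quotient.mk_surjective _ v
    refine Subtype.ext (congrArg (Ideal.Quotient.mk (P'.map f ⊔ Q'.map g)) (?_ :
      f (c * u) * g v = f c * (f u * g v)))
    rw [map_mul, mul_assoc]
  · intro c u v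
    obtain ⟨u, rfl⟩ := Submodule.Quotient.mk_surjective _ u
    obtain ⟨v, rfl⟩ := Submodule.Quotient.mk_surjective _ v
    refine Subtype.ext (congrArg (Ideal.Quotient.mk (P'.map f ⊔ Q'.map g)) (?_ :
      f u * g (c * v) = g c * (f u * g v)))
    rw [map_mul, mul_left_comm]

end

section
lemma nonempty_map_mkQ_equiv_pi {R M ι : Type*} [CommRing R] [AddCommGroup M] [Module R M]
    [Fintype ι] (N : Submodule R M) (K D : ι → Submodule R M)
    (hN : ∀ i, N ≤ K i) (hK : ⨅ i, K i ≤ N) (hD : ∀ i j, i ≠ j → D i ≤ K j) :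
    Nonempty ((⨆ i, D i).map N.mkQ ≃ₗ[R] ∀ i, (D i).map (K i).mkQ) := by
  classical
  have hmem (i) : ∀ x ∈ (⨆ i, D i).map N.mkQ, Submodule.factor (hN i) x ∈ (D i).map (K i).mkQ := by
    rintro _ ⟨x, hx, rfl⟩
    rw [Submodule.factor_mk]
    have : (⨆ j, D j).map (K i).mkQ ≤ (D i).map (K i).mkQ := by
      rw [Submodule.map_iSup, iSup_le_iff]
      intro j
      by_cases hji : j = i
      · rw [hji]
      · rw [Submodule.map_le_iff_le_comap]
        exact (hD j i hji).trans (Submodule.le_comap_mkQ _ _)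
    exact this ⟨x, hx, rfl⟩
  refine ⟨LinearEquiv.ofBijective
    (LinearMap.pi fun i ↦ (Submodule.factor (hN i)).restrict (hmem i)) ⟨?_, ?_⟩⟩
  · rw [← LinearMap.ker_eq_bot, eq_bot_iff]
    rintro ⟨_, x, hx, rfl⟩ h0
    have hx0 : x ∈ N := hK <| (Submodule.mem_iInf _).2 fun i ↦ by
      have := congr(($h0 i).1)
      rw [← Submodule.ker_mkQ (K i)]
      exact this
    exact Subtype.ext ((Submodule.Quotient.mk_eq_zero _).2 hx0)
  · intro y
    choose d hd hdy using fun i ↦ (y i).2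
    refine ⟨⟨N.mkQ (∑ i, d i), _, sum_mem fun i _ ↦ le_iSup D i (hd i), rfl⟩, ?_⟩
    ext i
    refine Eq.trans (?_ : _ = (K i).mkQ (∑ j, d j)) ?_
    · rfl
    rw [map_sum, Finset.sum_eq_single i, hdy]
    · intro j _ hji
      exact (Submodule.Quotient.mk_eq_zero _).2 (hD j i hji (hd j))
    · simp

namespace Ideal
variable {R : Type*} [CommRing R] (X Y : Ideal R)

lemma pow_mul_pow_le_sup_pow (p q : ℕ) : X ^ p * Y ^ q ≤ (X ⊔ Y) ^ (p + q) := by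
  rw [pow_add]
  exact Ideal.mul_mono (Ideal.pow_right_mono le_sup_left _) (Ideal.pow_right_mono le_sup_right _)

lemma sup_pow_eq_iSup (m : ℕ) :
    (X ⊔ Y) ^ m = ⨆ i : Fin (m + 1), X ^ (i : ℕ) * Y ^ (m - i) := by
  apply le_antisymm
  · rw [← Ideal.add_eq_sup, add_pow, Ideal.sum_eq_sup, Finset.sup_le_iff]
    intro i hi
    exact Ideal.mul_le_left.trans
      (le_iSup (fun i : Fin (m + 1) ↦ X ^ (i : ℕ) * Y ^ (m - i)) ⟨i, Finset.mem_range.1 hi⟩)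
  · refine iSup_le fun i ↦ ?_
    refine (pow_mul_pow_le_sup_pow X Y i (m - i)).trans_eq ?_
    congr 1
    lia

variable {X Y}

lemma pow_mul_pow_le_sup {i j p q : ℕ} (h : i ≤ p ∨ j ≤ q) : X ^ p * Y ^ q ≤ X ^ i ⊔ Y ^ j := by
  rcases h with h | h
  · exact Ideal.mul_le_left.trans ((Ideal.pow_le_pow_right h).trans le_sup_left)
  · exact Ideal.mul_le_right.trans ((Ideal.pow_le_pow_right h).trans le_sup_right)

lemma sup_pow_le_pow_sup_pow {i j m : ℕ} (h : i + j ≤ m + 1) :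
    (X ⊔ Y) ^ m ≤ X ^ i ⊔ Y ^ j := by
  rw [sup_pow_eq_iSup]
  exact iSup_le fun p ↦ pow_mul_pow_le_sup (by lia)

lemma iInf_pow_sup_pow_le (hXY : ∀ p q, X ^ p ⊓ Y ^ q ≤ X ^ p * Y ^ q) (m : ℕ) :
    ⨅ i : Fin (m + 1), (X ^ (i + 1 : ℕ) ⊔ Y ^ (m - i + 1)) ≤ (X ⊔ Y) ^ (m + 1) := by
  have key (t : ℕ) : t ≤ m + 1 → ⨅ i : Fin (m + 1), (X ^ (i + 1 : ℕ) ⊔ Y ^ (m - i + 1)) ≤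
      (X ⊔ Y) ^ (m + 1) ⊔ X ^ t := by
    induction t with
    | zero => simp
    | succ t ih =>
      intro ht
      have h1 : (X ⊔ Y) ^ (m + 1) ≤ X ^ (t + 1) ⊔ Y ^ (m - t + 1) :=
        sup_pow_le_pow_sup_pow (by lia)
      have h2 : X ^ t ⊓ Y ^ (m - t + 1) ≤ (X ⊔ Y) ^ (m + 1) := by
        refine (hXY _ _).trans ((pow_mul_pow_le_sup_pow X Y t _).trans_eq ?_)
        congr 1
        lia
      calc _ ≤ ((X ⊔ Y) ^ (m + 1) ⊔ X ^ t) ⊓ (X ^ (t + 1) ⊔ Y ^ (m - t + 1)) :=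
            le_inf (ih (by lia)) (iInf_le (fun i : Fin (m + 1) ↦
              X ^ (i + 1 : ℕ) ⊔ Y ^ (m - i + 1)) ⟨t, by lia⟩)
        _ = (X ⊔ Y) ^ (m + 1) ⊔ X ^ t ⊓ (Y ^ (m - t + 1) ⊔ X ^ (t + 1)) := by
            rw [sup_inf_assoc_of_le _ h1, sup_comm (X ^ (t + 1))]
        _ = (X ⊔ Y) ^ (m + 1) ⊔ (X ^ t ⊓ Y ^ (m - t + 1) ⊔ X ^ (t + 1)) := by
            rw [inf_sup_assoc_of_le _ (Ideal.pow_le_pow_right t.le_succ)]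
        _ ≤ _ := sup_le le_sup_left (sup_le (h2.trans le_sup_left) le_sup_right)
  exact (key (m + 1) le_rfl).trans (sup_le le_rfl (Ideal.pow_right_mono le_sup_left _))

lemma nonempty_map_mkQ_sup_pow_equiv_pi (hXY : ∀ p q, X ^ p ⊓ Y ^ q ≤ X ^ p * Y ^ q) (m : ℕ) :
    Nonempty (Submodule.map (Submodule.mkQ ((X ⊔ Y) ^ (m + 1))) ((X ⊔ Y) ^ m) ≃ₗ[R]
      ∀ i : Fin (m + 1), Submodule.map (Submodule.mkQ (X ^ (i + 1 : ℕ) ⊔ Y ^ (m - i + 1)))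
        (X ^ (i : ℕ) * Y ^ (m - i))) := by
  rw [sup_pow_eq_iSup X Y m]
  refine nonempty_map_mkQ_equiv_pi _ _ _ (fun i ↦ sup_pow_le_pow_sup_pow (by lia))
    (iInf_pow_sup_pow_le hXY m) fun i j hij ↦ pow_mul_pow_le_sup ?_
  have := Fin.val_ne_of_ne hij
  lia

end Ideal

variable {k A B R : Type} [Field k] [CommRing A] [CommRing B] [CommRing R] [Algebra k A]
  [Algebra k B] [Algebra k R] {f : A →ₐ[k] R} {g : B →ₐ[k] R}

lemma hasExtDepth_quotient_sup_pow_succ [IsNoetherianRing A] [IsNoetherianRing B]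
    (hfg : Function.Bijective (Algebra.TensorProduct.productMap f g)) {mA : Ideal A} {mB : Ideal B}
    (I : Ideal A) (J : Ideal B) {a b : ℕ → ℕ} {m : ℕ}
    (ha : ∀ i ≤ m, HasExtDepth mA ((I ^ i : Ideal A) ⧸
      (Submodule.comap (Submodule.subtype (I ^ i)) (I ^ (i + 1)))) (a i))
    (hb : ∀ j ≤ m, HasExtDepth mB ((J ^ j : Ideal B) ⧸
      (Submodule.comap (Submodule.subtype (J ^ j)) (J ^ (j + 1)))) (b j))
    {d i₀ : ℕ} (hi₀ : i₀ ≤ m) (hd : a i₀ + b (m - i₀) = d) (hmin : ∀ i ≤ m, d ≤ a i + b (m - i))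
    (hQ : ∀ i < d, Subsingleton (CategoryTheory.Abelian.Ext
      (ModuleCat.of R (R ⧸ (mA.map f ⊔ mB.map g)))
      (ModuleCat.of R (R ⧸ (I.map f ⊔ J.map g) ^ m)) i)) :
    HasExtDepth (mA.map f ⊔ mB.map g) (R ⧸ (I.map f ⊔ J.map g) ^ (m + 1)) d := by
  subst hd
  obtain ⟨e⟩ := Ideal.nonempty_map_mkQ_sup_pow_equiv_pi (X := I.map f) (Y := J.map g)
    (fun p q ↦ by simpa only [Ideal.map_pow] using map_inf_map_le_mul hfg (I ^ p) (J ^ q)) m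
  have hle : (I.map f ⊔ J.map g) ^ (m + 1) ≤ (I.map f ⊔ J.map g) ^ m :=
    Ideal.pow_le_pow_right m.le_succ
  refine HasExtDepth.of_exact (f := Submodule.subtype _) (g := Submodule.factor hle)
    (Submodule.subtype_injective _) (Submodule.factor_surjective hle) ?_
    (HasExtDepth.of_pi_equiv e (δ := fun i ↦ a i + b (m - i)) (fun i ↦ ?_) ⟨i₀, by lia⟩
      fun i ↦ hmin i (by lia)) hQ
  · rw [LinearMap.exact_iff, Submodule.range_subtype]
    simp [Submodule.factor, Submodule.mapQ, Submodule.ker_liftQ]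
  · have := hasExtDepth_map_mkQ_mul hfg (I ^ (i : ℕ)) (I ^ (i + 1 : ℕ)) (J ^ (m - i))
      (J ^ (m - i + 1)) (ha i (by lia)) (hb (m - i) (by lia))
    rw [Ideal.map_pow, Ideal.map_pow, Ideal.map_pow, Ideal.map_pow] at this
    exact this

end

section
lemma subsingleton_ext_of_subsingleton {R M N : Type} [CommRing R] [AddCommGroup M] [Module R M]
    [AddCommGroup N] [Module R N] [Subsingleton N] (i : ℕ) :
    Subsingleton (CategoryTheory.Abelian.Ext (ModuleCat.of R M) (ModuleCat.of R N) i) := by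
  have h0 := ModuleCat.isZero_of_subsingleton (ModuleCat.of R N)
  refine ⟨fun x y ↦ ?_⟩
  rw [← x.comp_mk₀_id, ← y.comp_mk₀_id, h0.eq_of_src (CategoryTheory.CategoryStruct.id _) 0,
    CategoryTheory.Abelian.Ext.mk₀_zero, CategoryTheory.Abelian.Ext.comp_zero,
    CategoryTheory.Abelian.Ext.comp_zero]

lemma smul_top_pow_quotient_ne_top {R : Type*} [CommRing R] [IsDomain R] [IsNoetherianRing R]
    {m I : Ideal R} (hm : m ≠ ⊤) (hI : I ≤ m) (hI0 : I ≠ ⊥) (i : ℕ) :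
    m • (⊤ : Submodule R ((I ^ i : Ideal R) ⧸
      (Submodule.comap (Submodule.subtype (I ^ i)) (I ^ (i + 1))))) ≠ ⊤ := by
  intro h
  have hle : I ^ i ≤ m • I ^ i := by
    intro x hx
    have h1 : Submodule.mkQ (Submodule.comap (Submodule.subtype (I ^ i)) (I ^ (i + 1))) ⟨x, hx⟩ ∈
        Submodule.map (Submodule.mkQ _) (m • (⊤ : Submodule R (I ^ i : Ideal R))) := by
      rw [Submodule.map_smul'', Submodule.map_top, Submodule.range_mkQ, h]
      trivial
    obtain ⟨y, hy, hxy⟩ := h1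
    have h2 : (y : R) ∈ m • I ^ i := by
      have := Submodule.mem_map_of_mem (f := Submodule.subtype (I ^ i)) hy
      rwa [Submodule.map_smul'', Submodule.map_top, Submodule.range_subtype] at this
    have h3 : (y : R) - x ∈ I ^ (i + 1) :=
      (Submodule.Quotient.eq (Submodule.comap (Submodule.subtype (I ^ i)) (I ^ (i + 1)))).1 hxy
    have h4 : I ^ (i + 1) ≤ m • I ^ i := by
      rw [pow_succ', smul_eq_mul]
      exact Ideal.mul_mono_left hI
    simpa using sub_mem h2 (h4 h3)
  obtain ⟨r, hr, hr0⟩ := Submodule.exists_sub_one_mem_and_smul_eq_zero_of_fg_of_le_smul m (I ^ i)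
    (IsNoetherian.noetherian _) hle
  obtain ⟨x, hx, hx0⟩ := Submodule.exists_mem_ne_zero_of_ne_bot (pow_ne_zero i hI0)
  obtain rfl : r = 0 := by simpa [hx0] using hr0 x hx
  exact hm ((Ideal.eq_top_iff_one _).2 (by simpa using hr))

end

namespace PaperHTT
variable {k : Type} [Field k]

lemma mem_maxHomIdeal_iff {σ : Type} {p : MvPolynomial σ k} :
    p ∈ maxHomIdeal k σ ↔ constantCoeff p = 0 := by
  rw [maxHomIdeal, ← Set.image_univ, mem_ideal_span_X_image, constantCoeff_eq, ← notMem_support_iff]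
  simp only [Set.mem_univ, true_and]
  refine ⟨fun h h0 ↦ ?_, fun h m hm ↦ DFunLike.ne_iff.1 fun h0 : m = 0 ↦ h (h0 ▸ hm)⟩
  obtain ⟨i, hi⟩ := h 0 h0
  exact hi rfl

lemma maxHomIdeal_ne_top (σ : Type) : maxHomIdeal k σ ≠ ⊤ := by
  rw [Ne, Ideal.eq_top_iff_one, mem_maxHomIdeal_iff]
  simp

lemma IsHomogeneousIdeal.le_maxHomIdeal {σ : Type} {I : Ideal (MvPolynomial σ k)}
    (hI : IsHomogeneousIdeal k I) (hI1 : I ≠ ⊤) : I ≤ maxHomIdeal k σ := by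
  intro p hp
  rw [mem_maxHomIdeal_iff]
  by_contra h0
  have := hI p hp 0
  rw [homogeneousComponent_zero] at this
  exact hI1 (Ideal.eq_top_of_isUnit_mem _ this ((isUnit_iff_ne_zero.2 h0).map C))

lemma map_rename_sup_maxHomIdeal (σ τ : Type) :
    (maxHomIdeal k σ).map (rename Sum.inl : MvPolynomial σ k →ₐ[k] MvPolynomial (σ ⊕ τ) k) ⊔
      (maxHomIdeal k τ).map (rename Sum.inr : MvPolynomial τ k →ₐ[k] MvPolynomial (σ ⊕ τ) k) =
      maxHomIdeal k (σ ⊕ τ) := by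
  rw [maxHomIdeal, maxHomIdeal, maxHomIdeal, Ideal.map_span, Ideal.map_span, ← Ideal.span_union,
    ← Set.range_comp, ← Set.range_comp, ← Set.Sum.elim_range]
  congr 2
  ext i
  cases i <;> simp

lemma bijective_productMap_rename (σ τ : Type) :
    Function.Bijective (Algebra.TensorProduct.productMap
      (rename Sum.inl : MvPolynomial σ k →ₐ[k] MvPolynomial (σ ⊕ τ) k)
      (rename Sum.inr : MvPolynomial τ k →ₐ[k] MvPolynomial (σ ⊕ τ) k)) := by
  have : Algebra.TensorProduct.productMap
      (rename Sum.inl : MvPolynomial σ k →ₐ[k] MvPolynomial (σ ⊕ τ) k)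
      (rename Sum.inr : MvPolynomial τ k →ₐ[k] MvPolynomial (σ ⊕ τ) k) =
      (tensorEquivSum k σ τ k).toAlgHom := by
    ext <;> simp
  rw [this]
  exact (tensorEquivSum k σ τ k).bijective

lemma hasExtDepth_depthSubQuot_pow {r : ℕ} {I : Ideal (PA k r)} (hI0 : I ≠ ⊥) (hI1 : I ≠ ⊤)
    (hI : IsHomogeneousIdeal k I) (i : ℕ) :
    HasExtDepth (maxHomIdeal k (Fin r)) (subQuot k (I ^ i) (I ^ (i + 1)))
      (depthSubQuot k (I ^ i) (I ^ (i + 1))) := by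
  have h := smul_top_pow_quotient_ne_top (maxHomIdeal_ne_top (Fin r)) (hI.le_maxHomIdeal hI1) hI0 i
  obtain ⟨d, hd⟩ := HasExtDepth.exists_of_smul_top_ne_top _ _ h
  rwa [depthSubQuot, depthM, hd.sInf_localCohomology h]

lemma depthQuot_eq_of_hasExtDepth {r s d : ℕ} {Q : Ideal (PR k r s)}
    (hQ : Q ≤ maxHomIdeal k (Fin r ⊕ Fin s))
    (hd : HasExtDepth (maxHomIdeal k (Fin r ⊕ Fin s)) (PR k r s ⧸ Q) d) : depthQuot k Q = d := by
  refine hd.sInf_localCohomology fun h ↦ maxHomIdeal_ne_top (k := k) (Fin r ⊕ Fin s) ?_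
  rw [Ideal.eq_top_iff_one]
  have h1 : Submodule.mkQ Q 1 ∈ Submodule.map (Submodule.mkQ Q)
      (maxHomIdeal k (Fin r ⊕ Fin s) • (⊤ : Ideal (PR k r s))) := by
    rw [Submodule.map_smul'', Submodule.map_top, Submodule.range_mkQ, h]
    trivial
  obtain ⟨y, hy, hxy⟩ := h1
  rw [smul_eq_mul, Ideal.mul_top] at hy
  simpa using sub_mem hy (hQ ((Submodule.Quotient.eq _).1 hxy))

end PaperHTT

open PaperHTT in
/-- Corollary 3.6(i): if `depth I^(i-1)/I^i ≥ depth I^i/I^(i+1)` for `1 ≤ i ≤ n-1`, and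
likewise for `J`, then
`depth R/(I+J)^n = min_(i+j=n-1) (depth I^i/I^(i+1) + depth J^j/J^(j+1))`. -/
theorem depth_quot_power_sum_eq_of_nonincreasing
    (k : Type) [Field k] (r s : ℕ)
    (I : Ideal (PA k r)) (J : Ideal (PB k s))
    (hI0 : I ≠ ⊥) (hI1 : I ≠ ⊤) (hIh : IsHomogeneousIdeal k I)
    (hJ0 : J ≠ ⊥) (hJ1 : J ≠ ⊤) (hJh : IsHomogeneousIdeal k J)
    (n : ℕ) (hn : 1 ≤ n)
    (hId : ∀ i : ℕ, 1 ≤ i → i ≤ n - 1 →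
      depthSubQuot k (I ^ i) (I ^ (i + 1)) ≤ depthSubQuot k (I ^ (i - 1)) (I ^ i))
    (hJd : ∀ i : ℕ, 1 ≤ i → i ≤ n - 1 →
      depthSubQuot k (J ^ i) (J ^ (i + 1)) ≤ depthSubQuot k (J ^ (i - 1)) (J ^ i)) :
    depthQuot k ((sumIJ k I J) ^ n) =
      sInf {v : ℕ | ∃ i j : ℕ, i + j = n - 1 ∧
        v = depthSubQuot k (I ^ i) (I ^ (i + 1)) + depthSubQuot k (J ^ j) (J ^ (j + 1))} := by
  have hIm := hIh.le_maxHomIdeal hI1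
  have hJm := hJh.le_maxHomIdeal hJ1
  have hfg := bijective_productMap_rename (k := k) (Fin r) (Fin s)
  have hmax := map_rename_sup_maxHomIdeal (k := k) (Fin r) (Fin s)
  set a : ℕ → ℕ := fun i ↦ depthSubQuot k (I ^ i) (I ^ (i + 1))
  set b : ℕ → ℕ := fun j ↦ depthSubQuot k (J ^ j) (J ^ (j + 1))
  let d (m : ℕ) : ℕ := sInf {v : ℕ | ∃ i j : ℕ, i + j = m ∧ v = a i + b j}
  have hd (m : ℕ) : ∃ i j : ℕ, i + j = m ∧ d m = a i + b j :=
    Nat.sInf_mem (s := {v : ℕ | ∃ i j : ℕ, i + j = m ∧ v = a i + b j}) ⟨_, 0, m, by simp, rfl⟩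
  have hd' (i j : ℕ) : d (i + j) ≤ a i + b j := Nat.sInf_le ⟨i, j, rfl, rfl⟩
  have hQ : sumIJ k I J ≤ maxHomIdeal k (Fin r ⊕ Fin s) :=
    (sup_le_sup (Ideal.map_mono hIm) (Ideal.map_mono hJm)).trans_eq hmax
  have key (m : ℕ) (hm : m ≤ n - 1) : HasExtDepth (maxHomIdeal k (Fin r ⊕ Fin s))
      (PR k r s ⧸ (sumIJ k I J) ^ (m + 1)) (d m) := by
    induction m with
    | zero =>
      obtain ⟨i, j, hij, hdij⟩ := hd 0
      obtain ⟨rfl, rfl⟩ : i = 0 ∧ j = 0 := by lia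
      rw [← hmax]
      refine hasExtDepth_quotient_sup_pow_succ hfg I J
        (fun i _ ↦ hasExtDepth_depthSubQuot_pow hI0 hI1 hIh i)
        (fun j _ ↦ hasExtDepth_depthSubQuot_pow hJ0 hJ1 hJh j) le_rfl hdij.symm
        (fun i hi ↦ ?_) fun i _ ↦ ?_
      · obtain rfl : i = 0 := by lia
        exact hdij.le
      · have : Subsingleton (PR k r s ⧸ (sumIJ k I J) ^ 0) :=
          Ideal.Quotient.subsingleton_iff.2 (by rw [pow_zero, Ideal.one_eq_top])
        exact subsingleton_ext_of_subsingleton (N := PR k r s ⧸ (sumIJ k I J) ^ 0) i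
    | succ m ih =>
      obtain ⟨i, j, hij, hdij⟩ := hd (m + 1)
      have hanti : d (m + 1) ≤ d m := by
        obtain ⟨p, q, hpq, hdpq⟩ := hd m
        have h1 := hd' (p + 1) q
        have h2 : a (p + 1) ≤ a p := hId (p + 1) (by lia) (by lia)
        rw [show p + 1 + q = m + 1 by lia] at h1
        lia
      have hv := (ih (by lia)).1
      rw [← hmax] at hv ⊢
      refine hasExtDepth_quotient_sup_pow_succ hfg I J
        (fun i _ ↦ hasExtDepth_depthSubQuot_pow hI0 hI1 hIh i)
        (fun j _ ↦ hasExtDepth_depthSubQuot_pow hJ0 hJ1 hJh j) (i₀ := i) (by lia) ?_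
        (fun i hi ↦ ?_) fun i hi ↦ hv i (hi.trans_le hanti)
      · rw [hdij, show m + 1 - i = j by lia]
      · have := hd' i (m + 1 - i)
        rwa [show i + (m + 1 - i) = m + 1 by lia] at this
  have h := key (n - 1) le_rfl
  rw [Nat.sub_add_cancel hn] at h
  exact depthQuot_eq_of_hasExtDepth ((Ideal.pow_le_self (by lia)).trans hQ) h
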